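/- (Minimal LD^R calculation) For arbitrary tuples of lines H and G with flattened sequences h = f(H) and g = f(G), the dynamic-programming value equals the reading-order-constrained minimal Levenshtein distance: D^R(|h|,|g|) = LD^R(H,G). -/

import Mathlib

open scoped Classical

/-- The Levenshtein distance between two lists: the minimal number of single-character
insertions, deletions and substitutions transforming the first list into the second. -/
def lev {α : Type*} [DecidableEq α] : List α → List α → ℕ
  | [], ys => ys.length
  | x :: xs, [] => (x :: xs).length
  | x :: xs, y :: ys =>
      min (lev xs ys + if x = y then 0 else 1)
        (min (lev xs (y :: ys) + 1) (lev (x :: xs) ys + 1))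
  termination_by xs ys => xs.length + ys.length

/-- `A ∈ 𝒜`: a `{0,1}`-valued matrix in which every row and every column
contains at most one `1`. -/
def ValidA {N M : ℕ} (A : Fin N → Fin M → Bool) : Prop :=
  (∀ y x x', A y x = true → A y x' = true → x = x') ∧
  (∀ y y' x, A y x = true → A y' x = true → y = y')

/-- The reading-order condition defining `𝒜^R ⊆ 𝒜`: whenever `A_{y,x} = A_{y',x'} = 1`
and `y < y'`, then `x < x'`. -/
def ReadOrder {N M : ℕ} (A : Fin N → Fin M → Bool) : Prop :=
  ∀ y y' x x', A y x = true → A y' x' = true → y < y' → x < x'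

/-- The cost `Σ_{(y,x)∈W(A)} LD(H_y,G_x) + Σ_{y∈U(A)} |H_y| + Σ_{x∈V(A)} |G_x|`
associated with an assignment matrix `A` between the tuples of lines `H` and `G`. -/
def costA {α : Type*} [DecidableEq α] (H G : List (List α))
    (A : Fin H.length → Fin G.length → Bool) : ℕ :=
  (∑ p : Fin H.length × Fin G.length, if A p.1 p.2 = true then lev (H.get p.1) (G.get p.2) else 0)
  + (∑ y : Fin H.length, if ∀ x, ¬ A y x = true then (H.get y).length else 0)
  + (∑ x : Fin G.length, if ∀ y, ¬ A y x = true then (G.get x).length else 0)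

/-- `LD^R(H,G)`: the minimum of the cost over all valid assignment matrices that
respect the reading order. -/
noncomputable def LDR {α : Type*} [DecidableEq α] (H G : List (List α)) : ℕ :=
  sInf {c : ℕ | ∃ A : Fin H.length → Fin G.length → Bool,
    ValidA A ∧ ReadOrder A ∧ c = costA H G A}

/-- The flatten function `f`: the separator `↵ ∉ Σ` is modelled by `none`, characters of
`Σ = α` by `some a`; a separator is written before, between and after the lines. -/
def flat {α : Type*} (H : List (List α)) : List (Option α) :=
  none :: H.flatMap (fun l => l.map some ++ [none])

/-- `h_i`, the `i`-th symbol (1-indexed) of a flattened sequence. -/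
def nth {α : Type*} (h : List (Option α)) (i : ℕ) : Option α :=
  h.getD (i - 1) none

/-- `i` is a line-break position of `h` (1-indexed): `h_i = ↵`. -/
def isBrk {α : Type*} (h : List (Option α)) (i : ℕ) : Prop :=
  1 ≤ i ∧ i ≤ h.length ∧ nth h i = none

/-- `b_h^{y-1}` for `i = b_h^y`: the largest break position strictly below `i`
(`0` if there is none). -/
noncomputable def prevBrk {α : Type*} (h : List (Option α)) (i : ℕ) : ℕ :=
  Nat.findGreatest (fun k => isBrk h k) (i - 1)

/-- The index `y` such that `i = b_h^y` (the number of break positions `≤ i`). -/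
noncomputable def brkIdx {α : Type*} (h : List (Option α)) (i : ℕ) : ℕ :=
  ((List.range i).filter (fun k => decide (isBrk h (k + 1)))).length

/-- `d^R(i,j)`: `0` if `h_i = g_j`; `1` if `h_i ≠ g_j` and both `h_i, g_j ∈ Σ`;
`∞` otherwise. -/
noncomputable def dR {α : Type*} (h g : List (Option α)) (i j : ℕ) : ℕ∞ :=
  if nth h i = nth g j then 0
  else if nth h i ≠ none ∧ nth g j ≠ none then 1
  else ⊤

/-- The dynamic program `D^R(i,j)` for `h = f(H)` and `g = f(G)`:
`D^R(0,0) = 0`, `D^R(i,0) = i`, `D^R(0,j) = j`; at pairs of break positions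
`(i,j) = (b_h^y, b_g^x)`,
`D^R(i,j) = min{ D^R(i−1,j−1); D^R(b_h^{y−1},j) + |H_{y−1}| if y ≥ 2;
D^R(i,b_g^{x−1}) + |G_{x−1}| if x ≥ 2 }`; at all other pairs,
`D^R(i,j) = min{ D^R(i−1,j−1) + d^R(i,j); D^R(i−1,j) + 1 if h_i ≠ ↵;
D^R(i,j−1) + 1 if g_j ≠ ↵ }`. -/
noncomputable def DR {α : Type*} (H G : List (List α)) : ℕ → ℕ → ℕ∞
  | 0, 0 => 0
  | i + 1, 0 => (i + 1 : ℕ)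
  | 0, j + 1 => (j + 1 : ℕ)
  | i + 1, j + 1 =>
    if isBrk (flat H) (i + 1) ∧ isBrk (flat G) (j + 1) then
      min (DR H G i j) <| min
        (if 2 ≤ brkIdx (flat H) (i + 1) then
            DR H G (prevBrk (flat H) (i + 1)) (j + 1)
              + ((H.getD (brkIdx (flat H) (i + 1) - 2) []).length : ℕ∞)
          else ⊤)
        (if 2 ≤ brkIdx (flat G) (j + 1) then
            DR H G (i + 1) (prevBrk (flat G) (j + 1))
              + ((G.getD (brkIdx (flat G) (j + 1) - 2) []).length : ℕ∞)
          else ⊤)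
    else
      min (DR H G i j + dR (flat H) (flat G) (i + 1) (j + 1)) <| min
        (if nth (flat H) (i + 1) ≠ none then DR H G i (j + 1) + 1 else ⊤)
        (if nth (flat G) (j + 1) ≠ none then DR H G (i + 1) j + 1 else ⊤)
  termination_by i j => i + j
  decreasing_by
  · omega
  · have := Nat.findGreatest_le (P := fun k => isBrk (flat H) k) (i + 1 - 1)
    unfold prevBrk
    omega
  · have := Nat.findGreatest_le (P := fun k => isBrk (flat G) k) (j + 1 - 1)
    unfold prevBrk
    omega
  · omega
  · omega
  · omega

/-- Costs of the elementary operations transforming a list over `α` into a list over `β`. -/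
structure EditCost (α β : Type*) where
  /-- Cost of deleting an entry. -/
  delete : α → ℕ
  /-- Cost of inserting an entry. -/
  insert : β → ℕ
  /-- Cost of substituting one entry by another. -/
  substitute : α → β → ℕ

section LineCost

variable {α β : Type*}

/-- The edit distance of two lists with respect to the operation costs `C`. -/
def editDist (C : EditCost α β) : List α → List β → ℕ
  | [], [] => 0
  | x :: xs, [] => C.delete x + editDist C xs []
  | [], y :: ys => C.insert y + editDist C [] ys
  | x :: xs, y :: ys =>
      min (C.delete x + editDist C xs (y :: ys))
        (min (C.insert y + editDist C (x :: xs) ys) (C.substitute x y + editDist C xs ys))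
  termination_by xs ys => xs.length + ys.length

@[simp]
theorem editDist_nil_nil (C : EditCost α β) : editDist C [] [] = 0 := by
  rw [editDist]

@[simp]
theorem editDist_cons_nil (C : EditCost α β) (x : α) (xs : List α) :
    editDist C (x :: xs) [] = C.delete x + editDist C xs [] := by
  rw [editDist]

@[simp]
theorem editDist_nil_cons (C : EditCost α β) (y : β) (ys : List β) :
    editDist C [] (y :: ys) = C.insert y + editDist C [] ys := by
  rw [editDist]

theorem editDist_cons_cons (C : EditCost α β) (x : α) (xs : List α) (y : β) (ys : List β) :
    editDist C (x :: xs) (y :: ys) =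
      min (C.delete x + editDist C xs (y :: ys))
        (min (C.insert y + editDist C (x :: xs) ys) (C.substitute x y + editDist C xs ys)) := by
  rw [editDist]

theorem editDist_nil_append_singleton (C : EditCost α β) (ys : List β) (b : β) :
    editDist C [] (ys ++ [b]) = editDist C [] ys + C.insert b := by
  induction ys with
  | nil => simp
  | cons y ys ih => simp only [List.cons_append, editDist_nil_cons, ih]; omega

theorem editDist_append_singleton_nil (C : EditCost α β) (xs : List α) (a : α) :
    editDist C (xs ++ [a]) [] = editDist C xs [] + C.delete a := by
  induction xs with
  | nil => simp
  | cons x xs ih => simp only [List.cons_append, editDist_cons_nil, ih]; omega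

/-- The recursion for `editDist` read from the right-hand end of the two lists. -/
theorem editDist_append_singleton (C : EditCost α β) (xs : List α) (ys : List β) (a : α) (b : β) :
    editDist C (xs ++ [a]) (ys ++ [b]) =
      min (editDist C xs ys + C.substitute a b)
        (min (editDist C xs (ys ++ [b]) + C.delete a)
          (editDist C (xs ++ [a]) ys + C.insert b)) := by
  induction xs generalizing ys with
  | nil =>
    induction ys with
    | nil =>
      simp only [List.nil_append, editDist_cons_cons, editDist_nil_cons, editDist_cons_nil,
        editDist_nil_nil]
      omega
    | cons y ys ih =>
      simp only [List.nil_append, List.cons_append] at ih ⊢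
      simp only [editDist_cons_cons, editDist_nil_cons, editDist_nil_append_singleton, ih]
      omega
  | cons x xs ihx =>
    induction ys with
    | nil =>
      have h := ihx []
      simp only [List.nil_append, List.cons_append] at h ⊢
      simp only [editDist_cons_cons, editDist_cons_nil, editDist_append_singleton_nil, h]
      omega
    | cons y ys ihy =>
      have h1 := ihx (y :: ys)
      have h2 := ihx ys
      simp only [List.cons_append] at ihy h1 h2 ⊢
      rw [editDist_cons_cons, editDist_cons_cons (xs := xs) (ys := ys ++ [b]),
        editDist_cons_cons (xs := xs ++ [a]) (ys := ys), editDist_cons_cons (xs := xs) (ys := ys),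
        ihy, h1, h2]
      simp only [← min_add_add_left, ← min_add_add_right]
      ac_rfl

variable [DecidableEq α]

/-- Unit costs: insertions, deletions and proper substitutions cost `1`. -/
def unitCost (α : Type*) [DecidableEq α] : EditCost α α where
  delete _ := 1
  insert _ := 1
  substitute a b := if a = b then 0 else 1

theorem lev_eq_editDist (xs ys : List α) : lev xs ys = editDist (unitCost α) xs ys := by
  induction xs generalizing ys with
  | nil =>
    rw [lev]
    induction ys with
    | nil => simp
    | cons y ys ih =>
      rw [editDist_nil_cons, ← ih]
      simp [unitCost, add_comm]
  | cons x xs ihx =>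
    induction ys with
    | nil =>
      rw [lev, editDist_cons_nil, ← ihx]
      cases xs <;> simp [lev, unitCost, add_comm]
    | cons y ys ihy =>
      rw [lev, editDist_cons_cons, ihx, ihx, ihy]
      simp only [unitCost]
      omega

/-- Costs for editing tuples of lines: removing or adding a line costs its length, replacing a line
by another one costs their Levenshtein distance. -/
def lineCost (α : Type*) [DecidableEq α] : EditCost (List α) (List α) where
  delete := List.length
  insert := List.length
  substitute := lev

end LineCost

section Assignment

variable {α : Type*} [DecidableEq α]

/-- `costA` for tuples of lines indexed by `Fin n` and `Fin m`. -/
def assignCost {n m : ℕ} (H : Fin n → List α) (G : Fin m → List α) (A : Fin n → Fin m → Bool) : ℕ :=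
  (∑ p : Fin n × Fin m, if A p.1 p.2 = true then lev (H p.1) (G p.2) else 0)
  + (∑ y : Fin n, if ∀ x, ¬ A y x = true then (H y).length else 0)
  + (∑ x : Fin m, if ∀ y, ¬ A y x = true then (G x).length else 0)

theorem assignCost_of_row_eq_false {n m : ℕ} (H : Fin (n + 1) → List α) (G : Fin m → List α)
    (A : Fin (n + 1) → Fin m → Bool) (h : ∀ x, A 0 x = false) :
    assignCost H G A = (H 0).length + assignCost (fun y => H y.succ) G (fun y x => A y.succ x) := by
  simp only [assignCost, Fintype.sum_prod_type, Fin.sum_univ_succ, Fin.forall_fin_succ, h]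
  simp
  omega

theorem assignCost_of_col_eq_false {n m : ℕ} (H : Fin n → List α) (G : Fin (m + 1) → List α)
    (A : Fin n → Fin (m + 1) → Bool) (h : ∀ y, A y 0 = false) :
    assignCost H G A = (G 0).length + assignCost H (fun x => G x.succ) (fun y x => A y x.succ) := by
  simp only [assignCost, Fintype.sum_prod_type, Fin.sum_univ_succ, Fin.forall_fin_succ, h]
  simp
  omega

theorem assignCost_of_zero_zero {n m : ℕ} (H : Fin (n + 1) → List α) (G : Fin (m + 1) → List α)
    (A : Fin (n + 1) → Fin (m + 1) → Bool) (h : A 0 0 = true)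
    (hr : ∀ x : Fin m, A 0 x.succ = false) (hc : ∀ y : Fin n, A y.succ 0 = false) :
    assignCost H G A = lev (H 0) (G 0) +
      assignCost (fun y => H y.succ) (fun x => G x.succ) (fun y x => A y.succ x.succ) := by
  simp only [assignCost, Fintype.sum_prod_type, Fin.sum_univ_succ, Fin.forall_fin_succ, h, hr, hc]
  simp
  omega

theorem ValidA.succ_row {n m : ℕ} {A : Fin (n + 1) → Fin m → Bool} (hA : ValidA A) :
    ValidA fun (y : Fin n) x => A y.succ x :=
  ⟨fun y => hA.1 y.succ, fun _ _ _ h1 h2 => Fin.succ_injective _ (hA.2 _ _ _ h1 h2)⟩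

theorem ValidA.succ_col {n m : ℕ} {A : Fin n → Fin (m + 1) → Bool} (hA : ValidA A) :
    ValidA fun y (x : Fin m) => A y x.succ :=
  ⟨fun _ _ _ h1 h2 => Fin.succ_injective _ (hA.1 _ _ _ h1 h2), fun y y' x => hA.2 y y' x.succ⟩

theorem ReadOrder.succ_row {n m : ℕ} {A : Fin (n + 1) → Fin m → Bool} (hA : ReadOrder A) :
    ReadOrder fun (y : Fin n) x => A y.succ x :=
  fun y y' x x' h1 h2 h => hA y.succ y'.succ x x' h1 h2 (Fin.succ_lt_succ_iff.2 h)

theorem ReadOrder.succ_col {n m : ℕ} {A : Fin n → Fin (m + 1) → Bool} (hA : ReadOrder A) :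
    ReadOrder fun y (x : Fin m) => A y x.succ :=
  fun y y' x x' h1 h2 h => Fin.succ_lt_succ_iff.1 (hA y y' x.succ x'.succ h1 h2 h)

/-- The first row and the first column of a reading-order assignment cannot both be matched,
unless they are matched with each other. -/
theorem ReadOrder.row_or_col_eq_false {n m : ℕ} {A : Fin (n + 1) → Fin (m + 1) → Bool}
    (hR : ReadOrder A) (h0 : ¬A 0 0 = true) : (∀ x, A 0 x = false) ∨ ∀ y, A y 0 = false := by
  by_contra! ⟨⟨x, hx⟩, y, hy⟩
  have hx' : A 0 x = true := by simpa using hx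
  have hy' : A y 0 = true := by simpa using hy
  have hy0 : y ≠ 0 := fun e => h0 (e ▸ hy')
  exact Fin.not_lt_zero x (hR _ _ _ _ hx' hy' (Fin.pos_iff_ne_zero.2 hy0))

theorem editDist_lineCost_le_assignCost (H G : List (List α))
    (A : Fin H.length → Fin G.length → Bool) (hA : ValidA A) (hR : ReadOrder A) :
    editDist (lineCost α) H G ≤ assignCost H.get G.get A := by
  induction H generalizing G with
  | nil =>
    induction G with
    | nil => simp
    | cons g G ih =>
      rw [assignCost_of_col_eq_false (m := G.length) _ _ _ (fun y => y.elim0), editDist_nil_cons]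
      exact Nat.add_le_add_left (ih _ hA.succ_col hR.succ_col) _
  | cons l H ihH =>
    induction G with
    | nil =>
      rw [assignCost_of_row_eq_false (n := H.length) _ _ _ (fun x => x.elim0), editDist_cons_nil]
      exact Nat.add_le_add_left (ihH _ _ hA.succ_row hR.succ_row) _
    | cons g G ihG =>
      rw [editDist_cons_cons]
      by_cases h0 : A 0 0 = true
      · have hr (x : Fin G.length) : A 0 x.succ = false := by
          by_contra h
          exact (Fin.succ_ne_zero x) (hA.1 _ _ _ (by simpa using h) h0)
        have hc (y : Fin H.length) : A y.succ 0 = false := by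
          by_contra h
          exact (Fin.succ_ne_zero y) (hA.2 _ _ _ (by simpa using h) h0)
        rw [assignCost_of_zero_zero (n := H.length) (m := G.length) _ _ _ h0 hr hc]
        refine (min_le_right _ _).trans ((min_le_right _ _).trans ?_)
        exact Nat.add_le_add_left (ihH _ _ hA.succ_row.succ_col hR.succ_row.succ_col) _
      · rcases hR.row_or_col_eq_false h0 with h | h
        · rw [assignCost_of_row_eq_false (n := H.length) _ _ _ h]
          refine (min_le_left _ _).trans ?_
          exact Nat.add_le_add_left (ihH _ _ hA.succ_row hR.succ_row) _
        · rw [assignCost_of_col_eq_false (m := G.length) _ _ _ h]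
          refine (min_le_right _ _).trans ((min_le_left _ _).trans ?_)
          exact Nat.add_le_add_left (ihG _ hA.succ_col hR.succ_col) _

/-- `c` is the cost of some valid assignment respecting the reading order. -/
def IsAssignCost (H G : List (List α)) (c : ℕ) : Prop :=
  ∃ A : Fin H.length → Fin G.length → Bool, ValidA A ∧ ReadOrder A ∧
    assignCost H.get G.get A = c

theorem IsAssignCost.cons_left {H G : List (List α)} {c : ℕ} (h : IsAssignCost H G c)
    (l : List α) : IsAssignCost (l :: H) G (l.length + c) := by
  obtain ⟨A, hA, hR, e⟩ := h
  have key : ∃ B : Fin (H.length + 1) → Fin G.length → Bool,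
      (∀ x, B 0 x = false) ∧ ∀ y x, B y.succ x = A y x :=
    ⟨Fin.cons (fun _ => false) A, by simp, by simp⟩
  obtain ⟨B, h0, hs⟩ := key
  refine ⟨B, ⟨?_, ?_⟩, ?_, ?_⟩
  · exact Fin.cases (by simp [h0]) fun y => by simpa [hs] using hA.1 y
  · refine Fin.cases (by simp [h0]) fun y => Fin.cases (by simp [h0]) fun y' => ?_
    simpa [hs] using hA.2 y y'
  · refine Fin.cases (by simp [h0]) fun y => Fin.cases (by simp [h0]) fun y' => ?_
    simpa [hs] using hR y y'
  · rw [assignCost_of_row_eq_false (n := H.length) _ _ _ h0, ← e]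
    simp only [hs]
    rfl

theorem IsAssignCost.cons_right {H G : List (List α)} {c : ℕ} (h : IsAssignCost H G c)
    (g : List α) : IsAssignCost H (g :: G) (g.length + c) := by
  obtain ⟨A, hA, hR, e⟩ := h
  have key : ∃ B : Fin H.length → Fin (G.length + 1) → Bool,
      (∀ y, B y 0 = false) ∧ ∀ y x, B y x.succ = A y x :=
    ⟨fun y => Fin.cons false (A y), by simp, by simp⟩
  obtain ⟨B, h0, hs⟩ := key
  refine ⟨B, ⟨fun y => ?_, fun y y' => ?_⟩, fun y y' => ?_, ?_⟩
  · refine Fin.cases (by simp [h0]) fun x => Fin.cases (by simp [h0]) fun x' => ?_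
    simpa [hs] using hA.1 y x x'
  · exact Fin.cases (by simp [h0]) fun x => by simpa [hs] using hA.2 y y' x
  · refine Fin.cases (by simp [h0]) fun x => Fin.cases (by simp [h0]) fun x' => ?_
    simpa [hs] using hR y y' x x'
  · rw [assignCost_of_col_eq_false (m := G.length) _ _ _ h0, ← e]
    simp only [hs]
    rfl

theorem IsAssignCost.cons_cons {H G : List (List α)} {c : ℕ} (h : IsAssignCost H G c)
    (l g : List α) : IsAssignCost (l :: H) (g :: G) (lev l g + c) := by
  obtain ⟨A, hA, hR, e⟩ := h
  have key : ∃ B : Fin (H.length + 1) → Fin (G.length + 1) → Bool, B 0 0 = true ∧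
      (∀ x : Fin G.length, B 0 x.succ = false) ∧ (∀ y : Fin H.length, B y.succ 0 = false) ∧
      ∀ y x, B y.succ x.succ = A y x :=
    ⟨Fin.cons (Fin.cons true fun _ => false) fun y => Fin.cons false (A y),
      by simp, by simp, by simp, by simp⟩
  obtain ⟨B, h0, hr, hc, hs⟩ := key
  refine ⟨B, ⟨?_, ?_⟩, ?_, ?_⟩
  · refine Fin.cases ?_ fun y => ?_ <;>
      refine Fin.cases ?_ fun x => ?_ <;> refine Fin.cases ?_ fun x' => ?_ <;>
      simp [hr, hc, hs]
    simpa using hA.1 y x x'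
  · refine Fin.cases ?_ fun y => ?_ <;> refine Fin.cases ?_ fun y' => ?_ <;>
      refine Fin.cases ?_ fun x => ?_ <;> simp [hr, hc, hs]
    simpa using hA.2 y y' x
  · refine Fin.cases ?_ fun y => ?_ <;> refine Fin.cases ?_ fun y' => ?_ <;>
      refine Fin.cases ?_ fun x => ?_ <;> refine Fin.cases ?_ fun x' => ?_ <;>
      simp [hr, hc, hs]
    simpa using hR y y' x x'
  · rw [assignCost_of_zero_zero (n := H.length) (m := G.length) _ _ _ h0 hr hc, ← e]
    simp only [hs]
    rfl

theorem isAssignCost_editDist (H G : List (List α)) :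
    IsAssignCost H G (editDist (lineCost α) H G) := by
  induction H generalizing G with
  | nil =>
    induction G with
    | nil => exact ⟨fun y => y.elim0, by simp [ValidA], by simp [ReadOrder], by simp [assignCost]⟩
    | cons g G ih =>
      rw [editDist_nil_cons]
      exact ih.cons_right g
  | cons l H ihH =>
    induction G with
    | nil =>
      rw [editDist_cons_nil]
      exact (ihH []).cons_left l
    | cons g G ihG =>
      rw [editDist_cons_cons]
      apply min_rec' (p := IsAssignCost (l :: H) (g :: G)) ((ihH _).cons_left l)
      exact min_rec' (p := IsAssignCost (l :: H) (g :: G)) (ihG.cons_right g)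
        ((ihH _).cons_cons l g)

theorem LDR_eq_editDist (H G : List (List α)) : LDR H G = editDist (lineCost α) H G := by
  have hcost (A) : costA H G A = assignCost H.get G.get A := rfl
  apply le_antisymm
  · obtain ⟨A, hA, hR, e⟩ := isAssignCost_editDist H G
    exact Nat.sInf_le ⟨A, hA, hR, by rw [hcost, e]⟩
  · obtain ⟨A, hA, hR, e⟩ := Nat.sInf_mem (s := {c : ℕ | ∃ A : Fin H.length → Fin G.length → Bool,
      ValidA A ∧ ReadOrder A ∧ c = costA H G A}) ⟨_, fun _ _ => false, by simp [ValidA],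
        by simp [ReadOrder], rfl⟩
    rw [LDR, e, hcost]
    exact editDist_lineCost_le_assignCost H G A hA hR

end Assignment

section Flat

variable {α : Type*}

theorem flat_append (P Q : List (List α)) :
    flat (P ++ Q) = flat P ++ Q.flatMap (fun l => l.map some ++ [none]) := by
  simp [flat]

theorem length_flat_concat (P : List (List α)) (l : List α) :
    (flat (P ++ [l])).length = (flat P).length + l.length + 1 := by
  simp [flat]
  omega

theorem length_flat_pos (P : List (List α)) : 0 < (flat P).length := by
  simp [flat]

theorem nth_flat_length (P Q : List (List α)) : nth (flat (P ++ Q)) (flat P).length = none := by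
  have hlast : (flat P)[(flat P).length - 1]? = some none := by
    rcases List.eq_nil_or_concat P with rfl | ⟨P, l, rfl⟩
    · simp [flat]
    · rw [← List.getLast?_eq_getElem?]
      simp [flat_append]
  have := length_flat_pos P
  rw [nth, flat_append, List.getD_eq_getElem?_getD, List.getElem?_append_left (by omega), hlast]
  rfl

theorem nth_flat_add (P Q : List (List α)) (l : List α) {k : ℕ} (hk : k < l.length) :
    nth (flat (P ++ l :: Q)) ((flat P).length + k + 1) = some l[k] := by
  rw [nth, flat_append, List.getD_eq_getElem?_getD, List.getElem?_append_right (by omega)]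
  have : (flat P).length + k + 1 - 1 - (flat P).length = k := by omega
  rw [this, List.flatMap_cons, List.append_assoc, List.getElem?_append_left (by simpa using hk)]
  simp [hk]

theorem isBrk_flat_length (P Q : List (List α)) : isBrk (flat (P ++ Q)) (flat P).length :=
  ⟨length_flat_pos P, by simp [flat_append], nth_flat_length P Q⟩

theorem isBrk_flat_end (P Q : List (List α)) (l : List α) :
    isBrk (flat (P ++ l :: Q)) ((flat P).length + l.length + 1) := by
  have h := isBrk_flat_length (P ++ [l]) Q
  rwa [length_flat_concat, List.append_assoc] at h

theorem not_isBrk_flat_add (P Q : List (List α)) (l : List α) {k : ℕ} (hk : k < l.length) :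
    ¬isBrk (flat (P ++ l :: Q)) ((flat P).length + k + 1) := fun h => by
  simpa [nth_flat_add P Q l hk] using h.2.2

theorem prevBrk_flat (P Q : List (List α)) (l : List α) :
    prevBrk (flat (P ++ l :: Q)) ((flat P).length + l.length + 1) = (flat P).length := by
  rw [prevBrk, Nat.findGreatest_eq_iff]
  refine ⟨by omega, fun _ => isBrk_flat_length _ _, fun n h1 h2 => ?_⟩
  obtain ⟨k, rfl⟩ := Nat.exists_eq_add_of_lt h1
  exact not_isBrk_flat_add P Q l (by omega)

theorem brkIdx_succ (h : List (Option α)) (i : ℕ) :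
    brkIdx h (i + 1) = brkIdx h i + if isBrk h (i + 1) then 1 else 0 := by
  rw [brkIdx, List.range_succ, List.filter_append, List.length_append, ← brkIdx]
  split_ifs with hb <;> simp [hb]

theorem brkIdx_flat_add (P Q : List (List α)) (l : List α) {k : ℕ} (hk : k ≤ l.length) :
    brkIdx (flat (P ++ l :: Q)) ((flat P).length + k) =
      brkIdx (flat (P ++ l :: Q)) (flat P).length := by
  induction k with
  | zero => rfl
  | succ k ih =>
    rw [← add_assoc, brkIdx_succ, ih (by omega), if_neg (not_isBrk_flat_add P Q l hk), add_zero]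

theorem brkIdx_flat_length (P Q : List (List α)) :
    brkIdx (flat (P ++ Q)) (flat P).length = P.length + 1 := by
  induction P using List.reverseRecOn generalizing Q with
  | nil =>
    have h := isBrk_flat_length [] Q
    have h1 : (flat ([] : List (List α))).length = 0 + 1 := by simp [flat]
    rw [h1] at h ⊢
    rw [brkIdx_succ, if_pos h]
    simp [brkIdx]
  | append_singleton P l ih =>
    rw [length_flat_concat, List.append_assoc, List.singleton_append, brkIdx_succ,
      if_pos (isBrk_flat_end P Q l), brkIdx_flat_add P Q l le_rfl, ih]
    simp

theorem brkIdx_flat_end (P Q : List (List α)) (l : List α) :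
    brkIdx (flat (P ++ l :: Q)) ((flat P).length + l.length + 1) = P.length + 2 := by
  have h := brkIdx_flat_length (P ++ [l]) Q
  rwa [length_flat_concat, List.append_assoc, List.length_append] at h

end Flat

section DynamicProgram

variable {α : Type*}

theorem DR_succ_succ_of_isBrk (H G : List (List α)) (i j : ℕ) (hi : isBrk (flat H) (i + 1))
    (hj : isBrk (flat G) (j + 1)) :
    DR H G (i + 1) (j + 1) =
      min (DR H G i j) (min
        (if 2 ≤ brkIdx (flat H) (i + 1) then
            DR H G (prevBrk (flat H) (i + 1)) (j + 1)
              + ((H.getD (brkIdx (flat H) (i + 1) - 2) []).length : ℕ∞)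
          else ⊤)
        (if 2 ≤ brkIdx (flat G) (j + 1) then
            DR H G (i + 1) (prevBrk (flat G) (j + 1))
              + ((G.getD (brkIdx (flat G) (j + 1) - 2) []).length : ℕ∞)
          else ⊤)) := by
  rw [DR, if_pos ⟨hi, hj⟩]

theorem DR_succ_succ_of_not_isBrk (H G : List (List α)) (i j : ℕ)
    (h : ¬(isBrk (flat H) (i + 1) ∧ isBrk (flat G) (j + 1))) :
    DR H G (i + 1) (j + 1) =
      min (DR H G i j + dR (flat H) (flat G) (i + 1) (j + 1)) (min
        (if nth (flat H) (i + 1) ≠ none then DR H G i (j + 1) + 1 else ⊤)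
        (if nth (flat G) (j + 1) ≠ none then DR H G (i + 1) j + 1 else ⊤)) := by
  rw [DR, if_neg h]

/-- Moving right inside a line of `G` along a line break of `H`. -/
theorem DR_flat_length_add (P P' Q Q' : List (List α)) (m : List α) {b : ℕ} (hb : b < m.length) :
    DR (P ++ P') (Q ++ m :: Q') (flat P).length ((flat Q).length + b + 1) =
      DR (P ++ P') (Q ++ m :: Q') (flat P).length ((flat Q).length + b) + 1 := by
  have hn := nth_flat_length P P'
  obtain ⟨i, hi⟩ := Nat.exists_eq_add_of_lt (length_flat_pos P)
  rw [zero_add] at hi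
  rw [hi] at hn ⊢
  rw [DR_succ_succ_of_not_isBrk _ _ _ _ fun h => not_isBrk_flat_add Q Q' m hb h.2]
  simp [dR, hn, nth_flat_add Q Q' m hb]

/-- Moving down inside a line of `H` along a line break of `G`. -/
theorem DR_flat_add_length (P P' Q Q' : List (List α)) (l : List α) {a : ℕ} (ha : a < l.length) :
    DR (P ++ l :: P') (Q ++ Q') ((flat P).length + a + 1) (flat Q).length =
      DR (P ++ l :: P') (Q ++ Q') ((flat P).length + a) (flat Q).length + 1 := by
  have hn := nth_flat_length Q Q'
  obtain ⟨j, hj⟩ := Nat.exists_eq_add_of_lt (length_flat_pos Q)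
  rw [zero_add] at hj
  rw [hj] at hn ⊢
  rw [DR_succ_succ_of_not_isBrk _ _ _ _ fun h => not_isBrk_flat_add P P' l ha h.1]
  simp [dR, hn, nth_flat_add P P' l ha]

theorem DR_zero_left (H G : List (List α)) (j : ℕ) : DR H G 0 j = j := by
  cases j <;> simp [DR]

theorem DR_zero_right (H G : List (List α)) (i : ℕ) : DR H G i 0 = i := by
  cases i <;> simp [DR]

variable [DecidableEq α]

theorem dR_flat_add_add (P P' Q Q' : List (List α)) {l m : List α} {a b : ℕ} (ha : a < l.length)
    (hb : b < m.length) :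
    dR (flat (P ++ l :: P')) (flat (Q ++ m :: Q')) ((flat P).length + a + 1)
      ((flat Q).length + b + 1) = ((unitCost α).substitute l[a] m[b] : ℕ) := by
  simp [dR, nth_flat_add P P' l ha, nth_flat_add Q Q' m hb, unitCost]

/-- Inside the rectangle spanned by a line of `H` and a line of `G`, the dynamic program computes
the Levenshtein distance of the prefixes. -/
theorem DR_flat_add_add (P P' Q Q' : List (List α)) (l m : List α) {a b : ℕ} (ha : a ≤ l.length)
    (hb : b ≤ m.length) :
    DR (P ++ l :: P') (Q ++ m :: Q') ((flat P).length + a) ((flat Q).length + b) =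
      DR (P ++ l :: P') (Q ++ m :: Q') (flat P).length (flat Q).length +
        (lev (l.take a) (m.take b) : ℕ∞) := by
  simp only [lev_eq_editDist]
  induction a generalizing b with
  | zero =>
    induction b with
    | zero => simp
    | succ b ih =>
      have ih := ih (by omega)
      rw [add_zero] at ih ⊢
      rw [← add_assoc, DR_flat_length_add P _ Q Q' m hb, ih, ← List.take_append_getElem hb,
        List.take_zero, editDist_nil_append_singleton]
      simp [unitCost, add_assoc]
  | succ a iha =>
    have ha' : a ≤ l.length := by omega
    induction b with
    | zero =>
      have h := iha ha' (Nat.zero_le _)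
      rw [add_zero] at h ⊢
      rw [← add_assoc, DR_flat_add_length P P' Q _ l ha, h, ← List.take_append_getElem ha,
        List.take_zero, editDist_append_singleton_nil]
      simp [unitCost, add_assoc]
    | succ b ihb =>
      have hb' : b ≤ m.length := by omega
      have h1 := iha ha' hb
      have h2 := ihb hb'
      rw [← add_assoc] at h1 h2 ⊢
      rw [← add_assoc, DR_succ_succ_of_not_isBrk _ _ _ _
        fun h => not_isBrk_flat_add P P' l ha h.1, h1, h2, iha ha' hb',
        dR_flat_add_add P P' Q Q' ha hb, nth_flat_add P P' l ha, nth_flat_add Q Q' m hb, ← List.take_append_getElem ha,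
        ← List.take_append_getElem hb, editDist_append_singleton]
      rw [(Nat.mono_cast (α := ℕ∞)).map_min, (Nat.mono_cast (α := ℕ∞)).map_min, ← min_add_add_left,
        ← min_add_add_left, if_pos (Option.some_ne_none _), if_pos (Option.some_ne_none _)]
      simp only [Nat.cast_add, add_assoc]
      rfl

theorem editDist_lineCost_nil_left (Q : List (List α)) :
    editDist (lineCost α) [] Q + Q.length + 1 = (flat Q).length := by
  induction Q using List.reverseRecOn with
  | nil => simp [flat]
  | append_singleton Q l ih =>
    rw [editDist_nil_append_singleton, length_flat_concat, ← ih]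
    simp [lineCost]
    omega

theorem editDist_lineCost_nil_right (P : List (List α)) :
    editDist (lineCost α) P [] + P.length + 1 = (flat P).length := by
  induction P using List.reverseRecOn with
  | nil => simp [flat]
  | append_singleton P l ih =>
    rw [editDist_append_singleton_nil, length_flat_concat, ← ih]
    simp [lineCost]
    omega

/-- At a pair of line breaks the dynamic program computes the edit distance of the tuples of lines
preceding them. -/
theorem DR_flat_length (P P' Q Q' : List (List α)) :
    DR (P ++ P') (Q ++ Q') (flat P).length (flat Q).length = editDist (lineCost α) P Q := by
  have hnil : (flat ([] : List (List α))).length = 0 + 1 := by simp [flat]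
  induction P using List.reverseRecOn generalizing P' Q Q' with
  | nil =>
    induction Q using List.reverseRecOn generalizing Q' with
    | nil =>
      have h1 := isBrk_flat_length [] P'
      have h2 := isBrk_flat_length [] Q'
      have h3 := brkIdx_flat_length [] P'
      have h4 := brkIdx_flat_length [] Q'
      rw [hnil] at h1 h2 h3 h4 ⊢
      rw [DR_succ_succ_of_isBrk _ _ _ _ h1 h2, h3, h4]
      simp [DR]
    | append_singleton Q m ih =>
      have h1 := isBrk_flat_length [] P'
      have h3 := brkIdx_flat_length [] P'
      have h5 := ih (m :: Q')
      have h6 := editDist_lineCost_nil_left Q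
      rw [List.append_assoc, List.singleton_append, length_flat_concat]
      rw [hnil] at h1 h3 h5 ⊢
      rw [DR_succ_succ_of_isBrk _ _ _ _ h1 (isBrk_flat_end Q Q' m), h3, brkIdx_flat_end,
        prevBrk_flat, h5, editDist_nil_append_singleton, DR_zero_left]
      simp only [lineCost] at h6 ⊢
      simp
      omega
  | append_singleton P l ihP =>
    rw [List.append_assoc, List.singleton_append, length_flat_concat]
    induction Q using List.reverseRecOn generalizing Q' with
    | nil =>
      have h1 := isBrk_flat_length [] Q'
      have h3 := brkIdx_flat_length [] Q'
      have h5 := ihP (l :: P') [] Q'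
      have h6 := editDist_lineCost_nil_right P
      rw [hnil] at h1 h3 h5 ⊢
      rw [DR_succ_succ_of_isBrk _ _ _ _ (isBrk_flat_end P P' l) h1, h3, brkIdx_flat_end,
        prevBrk_flat, h5, editDist_append_singleton_nil, DR_zero_right]
      simp only [lineCost] at h6 ⊢
      simp
      omega
    | append_singleton Q m ihQ =>
      have h1 := ihP (l :: P') Q (m :: Q')
      have h2 := ihP (l :: P') (Q ++ [m]) Q'
      have h3 := ihQ (m :: Q')
      have h4 := DR_flat_add_add P P' Q Q' l m le_rfl le_rfl
      rw [List.append_assoc, List.singleton_append, length_flat_concat] at h2 ⊢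
      rw [List.take_length, List.take_length, h1] at h4
      rw [DR_succ_succ_of_isBrk _ _ _ _ (isBrk_flat_end P P' l) (isBrk_flat_end Q Q' m),
        brkIdx_flat_end, brkIdx_flat_end, prevBrk_flat, prevBrk_flat, h2, h3, h4,
        editDist_append_singleton, (Nat.mono_cast (α := ℕ∞)).map_min,
        (Nat.mono_cast (α := ℕ∞)).map_min]
      simp [lineCost]

end DynamicProgram

/-- Minimal `LD^R` calculation: For arbitrary tuples of lines `H` and `G` with
flattened sequences `h = f(H)` and `g = f(G)`, the dynamic-programming value equals the
reading-order-constrained minimal Levenshtein distance: `D^R(|h|,|g|) = LD^R(H,G)`. -/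
theorem DR_eq_LDR {α : Type*} [DecidableEq α] (H G : List (List α)) :
    DR H G (flat H).length (flat G).length = (LDR H G : ℕ∞) := by
  have h := DR_flat_length H [] G []
  rwa [List.append_nil, List.append_nil, ← LDR_eq_editDist] at h
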